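/- Let $E\subset\mathbb{R}^n$ be nonempty and assume $0\le\alpha<\Mu(E)$. Then $\operatorname{dist}(\cdot,E)^{-\alpha}\in A_1(\mathbb{R}^n)$. -/

import Mathlib

open MeasureTheory Metric Set

noncomputable section

/-- An axis-parallel half-open cube in `ℝⁿ`, given by its lower corner and side length. -/
structure Cube (n : ℕ) where
  a : EuclideanSpace ℝ (Fin n)
  l : ℝ
  pos : 0 < l

/-- The set of points of a cube. -/
def Cube.set {n : ℕ} (P : Cube n) : Set (EuclideanSpace ℝ (Fin n)) :=
  {x | ∀ i, P.a i ≤ x i ∧ x i < P.a i + P.l}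

/-- A weight: locally integrable and a.e. positive. -/
def IsWeight {n : ℕ} (w : EuclideanSpace ℝ (Fin n) → ℝ) : Prop :=
  LocallyIntegrable w volume ∧ ∀ᵐ x ∂(volume : Measure (EuclideanSpace ℝ (Fin n))), 0 < w x

/-- The `A₁` inequality with constant `C`, over all axis-parallel cubes. -/
def A1With {n : ℕ} (w : EuclideanSpace ℝ (Fin n) → ℝ) (C : ℝ) : Prop :=
  ∀ P : Cube n, (⨍ x in P.set, w x) ≤ C * essInf w (volume.restrict P.set)

/-- Membership in the Muckenhoupt class `A₁`. -/
def MemA1 {n : ℕ} (w : EuclideanSpace ℝ (Fin n) → ℝ) : Prop :=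
  IsWeight w ∧ ∃ C : ℝ, A1With w C

/-- The `A_p` inequality with constant `C`, over all axis-parallel cubes. -/
def ApWith {n : ℕ} (w : EuclideanSpace ℝ (Fin n) → ℝ) (p C : ℝ) : Prop :=
  ∀ P : Cube n,
    (⨍ x in P.set, w x) * (⨍ x in P.set, w x ^ (1 / (1 - p))) ^ (p - 1) ≤ C

/-- Membership in the Muckenhoupt class `A_p`. -/
def MemAp {n : ℕ} (w : EuclideanSpace ℝ (Fin n) → ℝ) (p : ℝ) : Prop :=
  IsWeight w ∧ ∃ C : ℝ, ApWith w p C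

/-- `Q` is a dyadic subcube of `P`. -/
def IsDyadicSubcube {n : ℕ} (P Q : Cube n) : Prop :=
  ∃ (j : ℕ) (k : Fin n → ℕ), (∀ i, k i < 2 ^ j) ∧
    Q.l = P.l / 2 ^ j ∧ ∀ i, Q.a i = P.a i + P.l * k i / 2 ^ j

/-- A cube is `E`-free if it does not meet `E`. -/
def EFree {n : ℕ} (E : Set (EuclideanSpace ℝ (Fin n))) (Q : Cube n) : Prop :=
  Q.set ∩ E = ∅

/-- The measure `|𝓜(P)|` of a largest `E`-free dyadic subcube of `P`
(`0` if there is none). -/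
def maxFree {n : ℕ} (E : Set (EuclideanSpace ℝ (Fin n))) (P : Cube n) : ℝ :=
  sSup {v : ℝ | ∃ Q : Cube n, IsDyadicSubcube P Q ∧ EFree E Q ∧ v = (volume Q.set).toReal}

/-- Weak porosity with constants `c`, `δ`. -/
def WeaklyPorousWith {n : ℕ} (E : Set (EuclideanSpace ℝ (Fin n))) (c δ : ℝ) : Prop :=
  ∀ P : Cube n, ∃ (N : ℕ) (Q : Fin N → Cube n),
    (∀ k, IsDyadicSubcube P (Q k) ∧ EFree E (Q k)) ∧
    (∀ k m, k ≠ m → Disjoint (Q k).set (Q m).set) ∧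
    (∀ k, δ * maxFree E P ≤ (volume (Q k).set).toReal) ∧
    c * (volume P.set).toReal ≤ ∑ k, (volume (Q k).set).toReal

/-- A set is weakly porous if it is weakly porous with some constants `0 < c, δ < 1`. -/
def WeaklyPorous {n : ℕ} (E : Set (EuclideanSpace ℝ (Fin n))) : Prop :=
  ∃ c δ : ℝ, 0 < c ∧ c < 1 ∧ 0 < δ ∧ δ < 1 ∧ WeaklyPorousWith E c δ

/-- Porosity. -/
def Porous {n : ℕ} (E : Set (EuclideanSpace ℝ (Fin n))) : Prop :=
  ∃ c : ℝ, 0 < c ∧ ∀ (x : EuclideanSpace ℝ (Fin n)) (r : ℝ), 0 < r →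
    ∃ y : EuclideanSpace ℝ (Fin n), ball y (c * r) ⊆ ball x r \ E

/-- The distance weight `dist(·,E)^{-α}`. -/
def distw {n : ℕ} (E : Set (EuclideanSpace ℝ (Fin n))) (α : ℝ)
    (x : EuclideanSpace ℝ (Fin n)) : ℝ :=
  infDist x E ^ (-α)

/-- `h_E(B(x,R))`: the supremum of radii `t` of balls contained in `B(x,R) \ E`. -/
def hFree {n : ℕ} (E : Set (EuclideanSpace ℝ (Fin n))) (x : EuclideanSpace ℝ (Fin n))
    (R : ℝ) : ℝ :=
  sSup {t : ℝ | ∃ y ∈ ball x R, ball y t ⊆ ball x R \ E}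

/-- The set of admissible exponents in the definition of the Muckenhoupt exponent. -/
def MuckSet {n : ℕ} (E : Set (EuclideanSpace ℝ (Fin n))) : Set ℝ :=
  {α : ℝ | ∃ C : ℝ, ∀ x ∈ E, ∀ R r : ℝ, 0 < r → r < hFree E x R → hFree E x R ≤ R →
    (volume (thickening r E ∩ ball x R)).toReal ≤
      C * (hFree E x R / r) ^ (-α) * (volume (ball x R)).toReal}

open scoped Classical in
/-- The Muckenhoupt exponent of `E`. -/
def MuckExp {n : ℕ} (E : Set (EuclideanSpace ℝ (Fin n))) : ℝ :=
  if ∀ x ∈ E, ∀ R : ℝ, 0 < R → 0 < hFree E x R then sSup (MuckSet E) else 0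

end

section DistanceWeight

open Filter
open scoped ENNReal

variable {n : ℕ} {E : Set (EuclideanSpace ℝ (Fin n))}

lemma Cube.measurableSet (P : Cube n) : MeasurableSet P.set := by
  have : P.set = ⋂ i, {x : EuclideanSpace ℝ (Fin n) | P.a i ≤ x i ∧ x i < P.a i + P.l} := by
    ext x
    simp [Cube.set]
  rw [this]
  refine MeasurableSet.iInter fun i => ?_
  have hm : Measurable fun x : EuclideanSpace ℝ (Fin n) => x i := by fun_prop
  exact hm measurableSet_Ico

lemma Cube.corner_mem (P : Cube n) : P.a ∈ P.set := fun i => ⟨le_rfl, by linarith [P.pos]⟩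

lemma Cube.dist_le (P : Cube n) {x y : EuclideanSpace ℝ (Fin n)} (hx : x ∈ P.set)
    (hy : y ∈ P.set) : dist x y ≤ (n + 1) * P.l := by
  have hl := P.pos
  rw [EuclideanSpace.dist_eq]
  refine Real.sqrt_le_iff.2 ⟨by positivity, ?_⟩
  calc ∑ i, dist (x i) (y i) ^ 2 ≤ ∑ _i : Fin n, P.l ^ 2 := by
        refine Finset.sum_le_sum fun i _ => ?_
        refine pow_le_pow_left₀ dist_nonneg ?_ 2
        have h1 := hx i
        have h2 := hy i
        rw [Real.dist_eq, abs_le]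
        constructor <;> linarith
    _ = n * P.l ^ 2 := by simp
    _ ≤ ((n + 1) * P.l) ^ 2 := by
        have hn : (0 : ℝ) ≤ n := Nat.cast_nonneg n
        have : (n : ℝ) ≤ (n + 1) ^ 2 := by nlinarith
        rw [mul_pow]
        gcongr

lemma Cube.exists_ball_subset (P : Cube n) : ∃ c, ball c (P.l / 2) ⊆ P.set := by
  refine ⟨WithLp.toLp 2 fun i => P.a i + P.l / 2, fun x hx i => ?_⟩
  have h := (PiLp.norm_apply_le (x - WithLp.toLp 2 fun i => P.a i + P.l / 2) i).trans_lt
    (mem_ball_iff_norm.1 hx)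
  rw [Real.norm_eq_abs, abs_lt] at h
  simp only [PiLp.sub_apply] at h
  constructor <;> linarith [h.1, h.2]

lemma Cube.volume_pos (P : Cube n) : 0 < volume P.set := by
  obtain ⟨c, hc⟩ := P.exists_ball_subset
  exact (measure_ball_pos volume c (half_pos P.pos)).trans_le (measure_mono hc)

lemma Cube.volume_lt_top (P : Cube n) : volume P.set < ∞ := by
  refine lt_of_le_of_lt (measure_mono (t := closedBall P.a ((n + 1) * P.l)) ?_)
    measure_closedBall_lt_top
  exact fun x hx => P.dist_le hx P.corner_mem

/-- The volume of a ball is controlled by that of a cube of proportional size. -/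
lemma Cube.volume_ball_le (P : Cube n) (x : EuclideanSpace ℝ (Fin n)) {M : ℝ} (hM : 0 ≤ M) :
    volume (ball x (M * P.l)) ≤ ENNReal.ofReal ((2 * M) ^ n) * volume P.set := by
  obtain ⟨c, hc⟩ := P.exists_ball_subset
  have hl := P.pos
  refine le_trans ?_ (mul_le_mul_right (measure_mono hc) _)
  rcases isEmpty_or_nonempty (Fin n) with h | h
  · obtain rfl : n = 0 := by
      rcases Nat.eq_zero_or_pos n with h0 | h0
      · exact h0
      · exact (h.false ⟨0, h0⟩).elim
    simp only [pow_zero, ENNReal.ofReal_one, one_mul]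
    refine measure_mono fun y _ => ?_
    rw [Subsingleton.elim y c]
    exact mem_ball_self (by positivity)
  · rw [Measure.addHaar_ball volume x (by positivity), Measure.addHaar_ball volume c (by positivity),
      ← mul_assoc, ← ENNReal.ofReal_mul (by positivity), finrank_euclideanSpace_fin, ← mul_pow]
    apply le_of_eq
    congr 3
    ring

lemma mem_upperBounds_freeRadii {x : EuclideanSpace ℝ (Fin n)} (hx : x ∈ E) (R : ℝ) :
    R ∈ upperBounds {t : ℝ | ∃ y ∈ ball x R, ball y t ⊆ ball x R \ E} := by
  rintro t ⟨y, hy, hyt⟩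
  have hxt : x ∉ ball y t := fun h => (hyt h).2 hx
  rw [mem_ball, not_lt] at hxt
  rw [mem_ball, dist_comm] at hy
  linarith

lemma hFree_le {x : EuclideanSpace ℝ (Fin n)} (hx : x ∈ E) {R : ℝ} (hR : 0 < R) :
    hFree E x R ≤ R :=
  Real.sSup_le (mem_upperBounds_freeRadii hx R) hR.le

lemma infDist_le_hFree {x y : EuclideanSpace ℝ (Fin n)} (hx : x ∈ E) {R : ℝ}
    (h : dist y x + infDist y E ≤ R) (hy : dist y x < R) :
    infDist y E ≤ hFree E x R := by
  refine le_csSup ⟨R, mem_upperBounds_freeRadii hx R⟩ ⟨y, hy, fun z hz => ⟨?_, fun hzE => ?_⟩⟩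
  · rw [mem_ball] at hz ⊢
    linarith [dist_triangle z y x]
  · rw [mem_ball, dist_comm] at hz
    linarith [infDist_le_dist_of_mem (x := y) hzE]

/-- Below the Muckenhoupt exponent, all balls have holes and some larger exponent is admissible. -/
lemma exists_mem_muckSet_of_lt {α : ℝ} (h0 : 0 ≤ α) (h1 : α < MuckExp E) :
    (∀ x ∈ E, ∀ R : ℝ, 0 < R → 0 < hFree E x R) ∧ ∃ β ∈ MuckSet E, α < β := by
  unfold MuckExp at h1
  split_ifs at h1 with h
  · refine ⟨h, ?_⟩
    by_contra! hc
    exact absurd (Real.sSup_le hc h0) (not_le.2 h1)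
  · linarith

/-- The decay of the volumes of neighborhoods along dyadic radii. -/
lemma exists_volume_thickening_le {β : ℝ} (hβ : β ∈ MuckSet E) :
    ∃ C : ℝ, 0 < C ∧ ∀ x ∈ E, ∀ R : ℝ, 0 < R → 0 < hFree E x R → ∀ k : ℕ,
      volume (thickening (hFree E x R * (1 / 2) ^ k) E ∩ ball x R) ≤
        ENNReal.ofReal (C * ((2 : ℝ) ^ (-β)) ^ k) * volume (ball x R) := by
  obtain ⟨C, hC⟩ := hβ
  refine ⟨max C 1, by positivity, fun x hx R hR hh k => ?_⟩
  have hfin : volume (ball x R) ≠ ∞ := measure_ball_lt_top.ne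
  rcases Nat.eq_zero_or_pos k with rfl | hk
  · calc _ ≤ volume (ball x R) := measure_mono inter_subset_right
      _ ≤ _ := by
        refine le_mul_of_one_le_left' ?_
        rw [ENNReal.one_le_ofReal]
        simp
  · have hlt : hFree E x R * (1 / 2) ^ k < hFree E x R :=
      mul_lt_of_lt_one_right hh (pow_lt_one₀ (by norm_num) (by norm_num) hk.ne')
    have h := hC x hx R _ (by positivity) hlt (hFree_le hx hR)
    have hratio : hFree E x R / (hFree E x R * (1 / 2) ^ k) = 2 ^ k := by
      field_simp
      simp
    have hpow : ((2 : ℝ) ^ k) ^ (-β) = ((2 : ℝ) ^ (-β)) ^ k := by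
      rw [← Real.rpow_natCast, ← Real.rpow_natCast, ← Real.rpow_mul (by norm_num),
        ← Real.rpow_mul (by norm_num), mul_comm]
    rw [hratio, hpow] at h
    rw [← ENNReal.ofReal_toReal hfin, ← ENNReal.ofReal_mul (by positivity)]
    refine (ENNReal.le_ofReal_iff_toReal_le
      (measure_ne_top_of_subset inter_subset_right hfin) (by positivity)).2 (h.trans ?_)
    gcongr
    exact le_max_left _ _

lemma volume_closure_eq_zero (hne : E.Nonempty)
    (hpos : ∀ x ∈ E, ∀ R : ℝ, 0 < R → 0 < hFree E x R) {β : ℝ} (hβ : β ∈ MuckSet E)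
    (hβ0 : 0 < β) : volume (closure E) = 0 := by
  obtain ⟨C, hC0, hC⟩ := exists_volume_thickening_le hβ
  obtain ⟨x, hx⟩ := hne
  have hball : ∀ m : ℕ, volume (closure E ∩ ball x (m + 1)) = 0 := by
    intro m
    have hR : (0 : ℝ) < m + 1 := by positivity
    have hh := hpos x hx _ hR
    have hle : ∀ k : ℕ, volume (closure E ∩ ball x (m + 1)) ≤
        ENNReal.ofReal (C * ((2 : ℝ) ^ (-β)) ^ k) * volume (ball x (m + 1)) := fun k =>
      (measure_mono (inter_subset_inter_left _ (closure_subset_thickening (by positivity) E))).trans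
        (hC x hx _ hR hh k)
    have hlim : Tendsto (fun k : ℕ => ENNReal.ofReal (C * ((2 : ℝ) ^ (-β)) ^ k) *
        volume (ball x (m + 1))) atTop (nhds 0) := by
      have h2 : Tendsto (fun k : ℕ => C * ((2 : ℝ) ^ (-β)) ^ k) atTop (nhds 0) := by
        simpa using (tendsto_pow_atTop_nhds_zero_of_lt_one (by positivity)
          (Real.rpow_lt_one_of_one_lt_of_neg one_lt_two (neg_lt_zero.2 hβ0))).const_mul C
      have h3 := ENNReal.Tendsto.mul_const (ENNReal.tendsto_ofReal h2)
        (Or.inr (measure_ball_lt_top (μ := volume) (x := x) (r := m + 1)).ne)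
      simpa using h3
    exact le_antisymm (ge_of_tendsto' hlim hle) bot_le
  have hcover : closure E ⊆ ⋃ m : ℕ, closure E ∩ ball x (m + 1) := by
    intro y hy
    obtain ⟨m, hm⟩ := exists_nat_gt (dist y x)
    exact mem_iUnion.2 ⟨m, hy, by rw [mem_ball]; linarith⟩
  exact measure_mono_null hcover (measure_iUnion_null hball)

lemma ae_infDist_pos (hne : E.Nonempty) (h : volume (closure E) = 0) :
    ∀ᵐ y ∂(volume : Measure (EuclideanSpace ℝ (Fin n))), 0 < infDist y E := by
  filter_upwards [measure_eq_zero_iff_ae_notMem.1 h] with y hy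
  exact lt_of_le_of_ne infDist_nonneg fun h0 => hy ((mem_closure_iff_infDist_zero hne).2 h0.symm)

lemma measurable_distw (α : ℝ) : Measurable (distw E α) :=
  (measurable_infDist (s := E)).pow_const _

/-- Pointwise dyadic layering of the distance weight. -/
lemma distw_le_tsum (hne : E.Nonempty) {α h : ℝ} (h0 : 0 ≤ α) (hh : 0 < h)
    {y : EuclideanSpace ℝ (Fin n)} (hy : 0 < infDist y E) :
    ENNReal.ofReal (distw E α y) ≤ ENNReal.ofReal (h ^ (-α)) * (1 + ∑' k : ℕ,
      ENNReal.ofReal ((2 : ℝ) ^ α * ((2 : ℝ) ^ α) ^ k) *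
        (thickening (h * (1 / 2) ^ k) E).indicator 1 y) := by
  by_cases hd : h ≤ infDist y E
  · calc ENNReal.ofReal (distw E α y) ≤ ENNReal.ofReal (h ^ (-α)) :=
          ENNReal.ofReal_le_ofReal (Real.rpow_le_rpow_of_nonpos hh hd (neg_nonpos.2 h0))
      _ ≤ _ := le_mul_of_one_le_right' le_self_add
  · rw [not_le] at hd
    have hex : ∃ k : ℕ, h * (1 / 2) ^ (k + 1) ≤ infDist y E := by
      obtain ⟨k, hk⟩ := exists_pow_lt_of_lt_one (div_pos hy hh) (by norm_num : (1 / 2 : ℝ) < 1)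
      refine ⟨k, ?_⟩
      rw [lt_div_iff₀ hh] at hk
      have : (0 : ℝ) < (1 / 2) ^ k := by positivity
      rw [pow_succ]
      nlinarith
    classical
    obtain ⟨k, hk, hlt⟩ : ∃ k : ℕ, h * (1 / 2) ^ (k + 1) ≤ infDist y E ∧
        infDist y E < h * (1 / 2) ^ k := by
      refine ⟨Nat.find hex, Nat.find_spec hex, ?_⟩
      rcases hf : Nat.find hex with _ | j
      · simpa using hd
      · exact not_le.1 (Nat.find_min hex (m := j) (by omega))
    have hmem : y ∈ thickening (h * (1 / 2) ^ k) E :=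
      (mem_thickening_iff_infDist_lt hne).2 hlt
    have hpow : (h * (1 / 2) ^ (k + 1)) ^ (-α) =
        h ^ (-α) * ((2 : ℝ) ^ α * ((2 : ℝ) ^ α) ^ k) := by
      rw [Real.mul_rpow hh.le (by positivity), ← pow_succ', one_div, inv_pow,
        Real.inv_rpow (by positivity), Real.rpow_neg (x := (2 : ℝ) ^ (k + 1)) (by positivity) α, inv_inv,
        Real.rpow_pow_comm two_pos.le]
    calc ENNReal.ofReal (distw E α y)
        ≤ ENNReal.ofReal ((h * (1 / 2) ^ (k + 1)) ^ (-α)) := ENNReal.ofReal_le_ofReal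
          (Real.rpow_le_rpow_of_nonpos (by positivity) hk (neg_nonpos.2 h0))
      _ = ENNReal.ofReal (h ^ (-α)) * (ENNReal.ofReal ((2 : ℝ) ^ α * ((2 : ℝ) ^ α) ^ k) *
            (thickening (h * (1 / 2) ^ k) E).indicator 1 y) := by
        rw [hpow, ENNReal.ofReal_mul (by positivity), indicator_of_mem hmem, Pi.one_apply, mul_one]
      _ ≤ _ := by
        gcongr
        exact (ENNReal.le_tsum (f := fun k : ℕ => ENNReal.ofReal ((2 : ℝ) ^ α *
          ((2 : ℝ) ^ α) ^ k) * (thickening (h * (1 / 2) ^ k) E).indicator 1 y) k).trans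
          le_add_self

/-- The integral of the distance weight over a ball centered at the set. -/
lemma exists_lintegral_distw_le (hne : E.Nonempty) {α β : ℝ} (h0 : 0 ≤ α) (hαβ : α < β)
    (hβ : β ∈ MuckSet E) (hae : ∀ᵐ y ∂(volume : Measure (EuclideanSpace ℝ (Fin n))),
      0 < infDist y E) :
    ∃ K : ℝ, 0 ≤ K ∧ ∀ x ∈ E, ∀ R : ℝ, 0 < R → 0 < hFree E x R →
      ∫⁻ y in ball x R, ENNReal.ofReal (distw E α y) ≤
        ENNReal.ofReal (K * hFree E x R ^ (-α)) * volume (ball x R) := by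
  obtain ⟨C, hC0, hC⟩ := exists_volume_thickening_le hβ
  set q : ℝ := (2 : ℝ) ^ α * (2 : ℝ) ^ (-β) with hq
  have hq0 : 0 ≤ q := by positivity
  have hq1 : q < 1 := by
    rw [hq, ← Real.rpow_add two_pos]
    exact Real.rpow_lt_one_of_one_lt_of_neg one_lt_two (by linarith)
  refine ⟨1 + (2 : ℝ) ^ α * C * (1 - q)⁻¹, by
    have : 0 ≤ (1 - q)⁻¹ := inv_nonneg.2 (by linarith)
    positivity, fun x hx R hR hh => ?_⟩
  set h := hFree E x R
  have hind : ∀ k : ℕ, Measurable ((thickening (h * (1 / 2) ^ k) E).indicator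
      (1 : EuclideanSpace ℝ (Fin n) → ℝ≥0∞)) := fun k =>
    measurable_one.indicator isOpen_thickening.measurableSet
  have hmeas : Measurable fun y => 1 + ∑' k : ℕ,
      ENNReal.ofReal ((2 : ℝ) ^ α * ((2 : ℝ) ^ α) ^ k) *
        (thickening (h * (1 / 2) ^ k) E).indicator (1 : EuclideanSpace ℝ (Fin n) → ℝ≥0∞) y :=
    measurable_const.add (Measurable.tsum fun k => (hind k).const_mul _)
  calc ∫⁻ y in ball x R, ENNReal.ofReal (distw E α y)
      ≤ ∫⁻ y in ball x R, ENNReal.ofReal (h ^ (-α)) * (1 + ∑' k : ℕ,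
          ENNReal.ofReal ((2 : ℝ) ^ α * ((2 : ℝ) ^ α) ^ k) *
            (thickening (h * (1 / 2) ^ k) E).indicator 1 y) := by
        refine lintegral_mono_ae ?_
        filter_upwards [ae_restrict_of_ae hae] with y hy using distw_le_tsum hne h0 hh hy
    _ = ENNReal.ofReal (h ^ (-α)) * (volume (ball x R) + ∑' k : ℕ,
          ENNReal.ofReal ((2 : ℝ) ^ α * ((2 : ℝ) ^ α) ^ k) *
            volume (thickening (h * (1 / 2) ^ k) E ∩ ball x R)) := by
        rw [lintegral_const_mul _ hmeas,
          lintegral_add_left measurable_const,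
          lintegral_tsum fun k => ((hind k).const_mul _).aemeasurable]
        congr 2
        · simp
        · refine tsum_congr fun k => ?_
          rw [lintegral_const_mul _ (hind k),
            lintegral_indicator_one isOpen_thickening.measurableSet,
            Measure.restrict_apply isOpen_thickening.measurableSet]
    _ ≤ ENNReal.ofReal (h ^ (-α)) * (volume (ball x R) + ∑' k : ℕ,
          ENNReal.ofReal ((2 : ℝ) ^ α * C * q ^ k) * volume (ball x R)) := by
        refine mul_le_mul_right (add_le_add_right (ENNReal.tsum_le_tsum fun k => ?_) _) _
        calc _ ≤ ENNReal.ofReal ((2 : ℝ) ^ α * ((2 : ℝ) ^ α) ^ k) *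
              (ENNReal.ofReal (C * ((2 : ℝ) ^ (-β)) ^ k) * volume (ball x R)) := by
                gcongr
                exact hC x hx R hR hh k
          _ = _ := by
                rw [← mul_assoc, ← ENNReal.ofReal_mul (by positivity), hq, mul_pow]
                congr 2
                ring
    _ = _ := by
        have hs : HasSum (fun k : ℕ => (2 : ℝ) ^ α * C * q ^ k) ((2 : ℝ) ^ α * C * (1 - q)⁻¹) :=
          (hasSum_geometric_of_lt_one hq0 hq1).mul_left _
        have hnn : 0 ≤ (2 : ℝ) ^ α * C * (1 - q)⁻¹ := by
          have : 0 ≤ (1 - q)⁻¹ := inv_nonneg.2 (by linarith)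
          positivity
        rw [ENNReal.tsum_mul_right, ← ENNReal.ofReal_tsum_of_nonneg (fun k => by positivity)
          hs.summable, hs.tsum_eq, mul_comm (1 + _) (h ^ (-α)),
          ENNReal.ofReal_mul (p := h ^ (-α)) (by positivity), ENNReal.ofReal_add zero_le_one hnn,
          ENNReal.ofReal_one]
        ring

lemma locallyIntegrable_distw (hne : E.Nonempty)
    (hpos : ∀ x ∈ E, ∀ R : ℝ, 0 < R → 0 < hFree E x R) {α K : ℝ}
    (hK : ∀ x ∈ E, ∀ R : ℝ, 0 < R → 0 < hFree E x R →
      ∫⁻ y in ball x R, ENNReal.ofReal (distw E α y) ≤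
        ENNReal.ofReal (K * hFree E x R ^ (-α)) * volume (ball x R)) :
    LocallyIntegrable (distw E α) volume := by
  intro z
  obtain ⟨x, hx⟩ := hne
  have hR : 0 < dist z x + 1 := by positivity
  refine ⟨ball x (dist z x + 1), isOpen_ball.mem_nhds (by simp),
    (measurable_distw α).aestronglyMeasurable, ?_⟩
  rw [hasFiniteIntegral_iff_ofReal (ae_of_all _ fun y => show 0 ≤ distw E α y from
    Real.rpow_nonneg infDist_nonneg _)]
  exact (hK x hx _ hR (hpos x hx _ hR)).trans_lt
    (ENNReal.mul_lt_top ENNReal.ofReal_lt_top measure_ball_lt_top)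

lemma Cube.le_essInf (P : Cube n) {w : EuclideanSpace ℝ (Fin n) → ℝ} {m : ℝ}
    (h : ∀ᵐ y ∂(volume.restrict P.set), m ≤ w y) : m ≤ essInf w (volume.restrict P.set) := by
  have hnb : (ae (volume.restrict P.set)).NeBot := by
    rw [ae_neBot]
    exact fun h => P.volume_pos.ne' (Measure.restrict_eq_zero.1 h)
  refine le_liminf_of_le ?_ h
  have hfreq : ∃ N : ℕ, ∃ᶠ y in ae (volume.restrict P.set), w y ≤ N := by
    by_contra! hc
    obtain ⟨y, hy⟩ := (eventually_countable_forall.2 hc).exists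
    obtain ⟨N, hN⟩ := exists_nat_gt (w y)
    exact absurd (hy N) (not_lt.2 hN.le)
  obtain ⟨N, hN⟩ := hfreq
  exact IsCoboundedUnder.of_frequently_le hN

lemma Cube.setAverage_le (P : Cube n) {w : EuclideanSpace ℝ (Fin n) → ℝ} (hw : Measurable w)
    (hw0 : ∀ y, 0 ≤ w y) {c : ℝ} (hc : 0 ≤ c)
    (h : ∫⁻ y in P.set, ENNReal.ofReal (w y) ≤ ENNReal.ofReal c * volume P.set) :
    ⨍ y in P.set, w y ≤ c := by
  have hv : 0 < volume.real P.set := ENNReal.toReal_pos P.volume_pos.ne' P.volume_lt_top.ne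
  rw [setAverage_eq, smul_eq_mul, inv_mul_le_iff₀ hv,
    integral_eq_lintegral_of_nonneg_ae (ae_of_all _ hw0) hw.aestronglyMeasurable]
  refine (ENNReal.toReal_mono (ENNReal.mul_ne_top ENNReal.ofReal_ne_top P.volume_lt_top.ne)
    h).trans_eq ?_
  rw [ENNReal.toReal_mul, ENNReal.toReal_ofReal hc, mul_comm]
  rfl

/-- The `A₁` inequality on cubes far away from the set. -/
lemma setAverage_distw_le_of_far {α : ℝ} (h0 : 0 ≤ α) (P : Cube n)
    (hfar : 2 * ((n + 1) * P.l) ≤ infDist P.a E) :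
    ⨍ y in P.set, distw E α y ≤ 4 ^ α * essInf (distw E α) (volume.restrict P.set) := by
  have hl := P.pos
  set ρ := infDist P.a E
  have hρ0 : 0 < ρ := lt_of_lt_of_le (by positivity) hfar
  have hlow : ∀ y ∈ P.set, ρ / 2 ≤ infDist y E := fun y hy => by
    linarith [infDist_le_infDist_add_dist (s := E) (x := P.a) (y := y),
      P.dist_le P.corner_mem hy]
  have hup : ∀ y ∈ P.set, infDist y E ≤ 2 * ρ := fun y hy => by
    linarith [infDist_le_infDist_add_dist (s := E) (x := y) (y := P.a),
      P.dist_le hy P.corner_mem]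
  have hess : (2 * ρ) ^ (-α) ≤ essInf (distw E α) (volume.restrict P.set) := by
    refine P.le_essInf ((ae_restrict_iff' P.measurableSet).2 (ae_of_all _ fun y hy => ?_))
    exact Real.rpow_le_rpow_of_nonpos (by linarith [hlow y hy]) (hup y hy) (neg_nonpos.2 h0)
  have havg : ⨍ y in P.set, distw E α y ≤ (ρ / 2) ^ (-α) := by
    refine P.setAverage_le (measurable_distw α) (fun y => Real.rpow_nonneg infDist_nonneg _)
      (by positivity) ?_
    rw [← setLIntegral_const]
    refine setLIntegral_mono measurable_const fun y hy => ENNReal.ofReal_le_ofReal ?_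
    exact Real.rpow_le_rpow_of_nonpos (by positivity) (hlow y hy) (neg_nonpos.2 h0)
  refine havg.trans (le_trans (le_of_eq ?_) (mul_le_mul_of_nonneg_left hess (by positivity)))
  have : 2 * ρ = 4 * (ρ / 2) := by ring
  rw [this, Real.mul_rpow (by norm_num) (by positivity), ← mul_assoc,
    ← Real.rpow_add (by norm_num)]
  simp

/-- The `A₁` inequality on cubes close to the set. -/
lemma setAverage_distw_le_of_near (hne : E.Nonempty)
    (hpos : ∀ x ∈ E, ∀ R : ℝ, 0 < R → 0 < hFree E x R) {α K : ℝ} (h0 : 0 ≤ α) (hK0 : 0 ≤ K)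
    (hK : ∀ x ∈ E, ∀ R : ℝ, 0 < R → 0 < hFree E x R →
      ∫⁻ y in ball x R, ENNReal.ofReal (distw E α y) ≤
        ENNReal.ofReal (K * hFree E x R ^ (-α)) * volume (ball x R))
    (hae : ∀ᵐ y ∂(volume : Measure (EuclideanSpace ℝ (Fin n))), 0 < infDist y E)
    (P : Cube n) (hnear : infDist P.a E < 2 * ((n + 1) * P.l)) :
    ⨍ y in P.set, distw E α y ≤
      (2 * (6 * (n + 1))) ^ n * K * essInf (distw E α) (volume.restrict P.set) := by
  have hl := P.pos
  obtain ⟨x, hx, hxP⟩ := (infDist_lt_iff hne).1 hnear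
  have hd : 0 < (n + 1) * P.l := by positivity
  have hR : 0 < 6 * (n + 1) * P.l := by positivity
  set h := hFree E x (6 * (n + 1) * P.l)
  have hh0 : 0 < h := hpos x hx _ hR
  have hdist : ∀ y ∈ P.set, dist y x < 3 * ((n + 1) * P.l) := fun y hy => by
    linarith [dist_triangle y P.a x, P.dist_le hy P.corner_mem]
  have hup : ∀ y ∈ P.set, infDist y E ≤ h := fun y hy => by
    have h1 := hdist y hy
    have h2 := infDist_le_dist_of_mem (x := y) hx
    exact infDist_le_hFree hx (by linarith) (by linarith)
  have hess : h ^ (-α) ≤ essInf (distw E α) (volume.restrict P.set) := by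
    refine P.le_essInf ((ae_restrict_iff' P.measurableSet).2 ?_)
    filter_upwards [hae] with y hy0 hy
    exact Real.rpow_le_rpow_of_nonpos hy0 (hup y hy) (neg_nonpos.2 h0)
  refine le_trans ?_ (mul_le_mul_of_nonneg_left hess (by positivity))
  refine P.setAverage_le (measurable_distw α) (fun y => Real.rpow_nonneg infDist_nonneg _)
    (by positivity) ?_
  have hsub : P.set ⊆ ball x (6 * (n + 1) * P.l) := fun y hy => by
    rw [mem_ball]
    linarith [hdist y hy]
  calc ∫⁻ y in P.set, ENNReal.ofReal (distw E α y)
      ≤ ∫⁻ y in ball x (6 * (n + 1) * P.l), ENNReal.ofReal (distw E α y) :=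
        lintegral_mono_set hsub
    _ ≤ ENNReal.ofReal (K * h ^ (-α)) * volume (ball x (6 * (n + 1) * P.l)) := hK x hx _ hR hh0
    _ ≤ ENNReal.ofReal (K * h ^ (-α)) *
          (ENNReal.ofReal ((2 * (6 * (n + 1))) ^ n) * volume P.set) := by
        gcongr
        exact P.volume_ball_le x (by positivity)
    _ = _ := by
        rw [← mul_assoc, ← ENNReal.ofReal_mul (by positivity)]
        congr 2
        ring

end DistanceWeight

/-- If `0 ≤ α < Mu(E)` then `dist(·,E)^{-α} ∈ A₁`. -/
theorem lt_muckExp_implies_a1 {n : ℕ} (E : Set (EuclideanSpace ℝ (Fin n)))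
    (hne : E.Nonempty) (α : ℝ) (h0 : 0 ≤ α) (h1 : α < MuckExp E) :
    MemA1 (distw E α) := by
  obtain ⟨hpos, β, hβ, hαβ⟩ := exists_mem_muckSet_of_lt h0 h1
  have hae := ae_infDist_pos hne
    (volume_closure_eq_zero hne hpos hβ (h0.trans_lt hαβ))
  obtain ⟨K, hK0, hK⟩ := exists_lintegral_distw_le hne h0 hαβ hβ hae
  refine ⟨⟨locallyIntegrable_distw hne hpos hK, ?_⟩,
    max (4 ^ α) ((2 * (6 * (n + 1))) ^ n * K), fun P => ?_⟩
  · filter_upwards [hae] with y hy using Real.rpow_pos_of_pos hy _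
  · have hess : 0 ≤ essInf (distw E α) (volume.restrict P.set) :=
      P.le_essInf (Filter.Eventually.of_forall fun y => Real.rpow_nonneg infDist_nonneg _)
    rcases le_or_gt (2 * ((n + 1) * P.l)) (infDist P.a E) with hfar | hnear
    · exact (setAverage_distw_le_of_far h0 P hfar).trans
        (mul_le_mul_of_nonneg_right (le_max_left _ _) hess)
    · exact (setAverage_distw_le_of_near hne hpos h0 hK0 hK hae P hnear).trans
        (mul_le_mul_of_nonneg_right (le_max_right _ _) hess)
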